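/- Let A be a finite nonempty linearly ordered set with elements a_1 < a_2 < … < a_n. The discrete vector field V_A on the poset P_A of ordered partitions of A has exactly one critical cell, namely the 0-dimensional cell u_A = a_1|a_2|…|a_n. -/

import Mathlib

section Core

variable {A : Type*} [DecidableEq A] [Fintype A]

/-- A cube of the standard `A`-cube: `none` means `*`, `some true` means `1`,
`some false` means `0`. -/
abbrev Cube (A : Type*) := A → Option Bool

/-- The cube `c(O, S, rest)` with value `1` on `O`, `*` on `S` and `0` elsewhere. -/
def cubeOn (O S : Finset A) : Cube A := fun a =>
  if a ∈ S then none else if a ∈ O then some true else some false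

/-- An `A`-cubical complex: a set of cubes closed under the face maps, i.e. under
replacing any occurrence of `*` by `0` or `1`. -/
def IsComplex (K : Set (Cube A)) : Prop :=
  ∀ c ∈ K, ∀ a : A, c a = none → ∀ ε : Bool, Function.update c a (some ε) ∈ K

/-- Union of the blocks of a list of finsets. -/
def blocksUnion (L : List (Finset A)) : Finset A := L.foldr (· ∪ ·) ∅

/-- `L` is an ordered partition of `S`: a sequence of nonempty pairwise disjoint
subsets whose union is `S`. -/
def IsOPart (S : Finset A) (L : List (Finset A)) : Prop :=
  (∀ B ∈ L, B.Nonempty) ∧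
    List.Pairwise (fun B C : Finset A => Disjoint B C) L ∧ blocksUnion L = S

/-- The set `P_K` of ordered partitions `L = B₁|…|B_l` of `S` such that each cube
`c((O ∪ B₁∪…∪B_{i-1}), B_i, rest)` belongs to `K`.  Here `O` records the part of the
ambient set on which the cubes take the fixed value `1` (used for the restrictions
`K|_B^ε`); for the full complex take `O = ∅`, `S = univ`. -/
def PK (K : Set (Cube A)) (O S : Finset A) : Set (List (Finset A)) :=
  {L | IsOPart S L ∧ ∀ (i : ℕ) (h : i < L.length),
    cubeOn (O ∪ blocksUnion (L.take i)) (L[i]'h) ∈ K}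

/-- `x` refines `y`: the blocks of `y` are obtained by uniting consecutive blocks of `x`. -/
def Refines (x y : List (Finset A)) : Prop :=
  ∃ LL : List (List (Finset A)), (∀ l ∈ LL, l ≠ []) ∧
    x = LL.flatten ∧ y = LL.map blocksUnion

/-- Dimension of an ordered partition: `Σ (#Bᵢ - 1)`. -/
def pdim (L : List (Finset A)) : ℕ := (L.map fun B => B.card - 1).sum

/-- The facet relation on ordered partitions. -/
def PFacet (x y : List (Finset A)) : Prop :=
  Refines x y ∧ x ≠ y ∧ pdim y = pdim x + 1

/-- A cycle of a discrete vector field on a poset of ordered partitions. -/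
def PCycle (V : Set (List (Finset A) × List (Finset A))) (k : ℕ)
    (a : Fin (k + 1) → List (Finset A)) (b : Fin k → List (Finset A)) : Prop :=
  0 < k ∧ a 0 = a (Fin.last k) ∧
    ∀ i : Fin k, (a i.castSucc, b i) ∈ V ∧ (a i.succ, b i) ∉ V ∧ PFacet (a i.succ) (b i)

/-- A discrete vector field on ordered partitions is a gradient field if it has no cycle. -/
def PGradient (V : Set (List (Finset A) × List (Finset A))) : Prop :=
  ∀ k a b, ¬ PCycle V k a b

/-- Critical cells of a discrete vector field `V` on the set of cells `S`. -/
def CritOn (S : Set (List (Finset A)))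
    (V : Set (List (Finset A) × List (Finset A))) : Set (List (Finset A)) :=
  {x | x ∈ S ∧ ∀ p ∈ V, p.1 ≠ x ∧ p.2 ≠ x}

end Core
section MemV

variable {A : Type*} [LinearOrder A] [Fintype A]

/-- The inductively defined standard gradient field `V_S` on ordered partitions of a
finite subset `S` of a linear order: `V_∅ = ∅`, and for nonempty `S` with maximum `m`,
`V_S = V_{S'}|m ∪ V^r_S` where `V^r_S = {(π|m|B|ρ, π|(B∪{m})|ρ)}`. -/
inductive memV : Finset A → List (Finset A) → List (Finset A) → Prop where
  | mstep (S : Finset A) (hS : S.Nonempty) (x y : List (Finset A)) :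
      memV (S.erase (S.max' hS)) x y →
      memV S (x ++ [({S.max' hS} : Finset A)]) (y ++ [({S.max' hS} : Finset A)])
  | rstep (S : Finset A) (hS : S.Nonempty) (C B D : Finset A)
      (π ρ : List (Finset A)) (hB : B.Nonempty)
      (hCB : Disjoint C B) (hCD : Disjoint C D) (hBD : Disjoint B D)
      (hU : C ∪ B ∪ D = S.erase (S.max' hS))
      (hπ : IsOPart C π) (hρ : IsOPart D ρ) :
      memV S (π ++ [({S.max' hS} : Finset A)] ++ [B] ++ ρ)
        (π ++ [insert (S.max' hS) B] ++ ρ)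

end MemV

section OrderedPartitions

variable {A : Type*} [DecidableEq A]

theorem mem_blocksUnion {L : List (Finset A)} {a : A} :
    a ∈ blocksUnion L ↔ ∃ B ∈ L, a ∈ B := by
  induction L with
  | nil => simp [blocksUnion]
  | cons B L ih =>
    have h : blocksUnion (B :: L) = B ∪ blocksUnion L := rfl
    simp [h, ih]

theorem blocksUnion_append (L M : List (Finset A)) :
    blocksUnion (L ++ M) = blocksUnion L ∪ blocksUnion M := by
  ext a
  simp [mem_blocksUnion, or_and_right, exists_or]

theorem blocksUnion_cons (B : Finset A) (L : List (Finset A)) :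
    blocksUnion (B :: L) = B ∪ blocksUnion L := rfl

theorem disjoint_blocksUnion_right {B : Finset A} {L : List (Finset A)} :
    Disjoint B (blocksUnion L) ↔ ∀ C ∈ L, Disjoint B C := by
  simp only [Finset.disjoint_left, mem_blocksUnion]
  grind

theorem disjoint_blocksUnion_left {B : Finset A} {L : List (Finset A)} :
    Disjoint (blocksUnion L) B ↔ ∀ C ∈ L, Disjoint C B := by
  simp only [Finset.disjoint_left, mem_blocksUnion]
  grind

theorem isOPart_append {S : Finset A} {L M : List (Finset A)} :
    IsOPart S (L ++ M) ↔ IsOPart (blocksUnion L) L ∧ IsOPart (blocksUnion M) M ∧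
      Disjoint (blocksUnion L) (blocksUnion M) ∧ blocksUnion L ∪ blocksUnion M = S := by
  simp only [IsOPart, List.pairwise_append, blocksUnion_append, disjoint_blocksUnion_left,
    disjoint_blocksUnion_right, List.mem_append]
  grind

theorem isOPart_cons {S B : Finset A} {L : List (Finset A)} :
    IsOPart S (B :: L) ↔ B.Nonempty ∧ IsOPart (blocksUnion L) L ∧
      Disjoint B (blocksUnion L) ∧ B ∪ blocksUnion L = S := by
  simp only [IsOPart, List.pairwise_cons, blocksUnion_cons, disjoint_blocksUnion_right,
    List.mem_cons]
  grind

theorem isOPart_empty {L : List (Finset A)} (h : IsOPart ∅ L) : L = [] := by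
  cases L with
  | nil => rfl
  | cons B L =>
    obtain ⟨hB, -, -, hU⟩ := isOPart_cons.1 h
    simp [Finset.union_eq_empty, hB.ne_empty] at hU

theorem append_cons_eq_append_singleton {α : Type*} {l₁ l₂ l : List α} {a b : α}
    (h : l₁ ++ a :: l₂ = l ++ [b]) (ha : a ∉ l) : l₂ = [] ∧ l₁ = l ∧ a = b := by
  rcases List.eq_nil_or_concat l₂ with rfl | ⟨k, c, rfl⟩
  · simpa using h
  · have h' : (l₁ ++ a :: k) ++ [c] = l ++ [b] := by simpa using h
    obtain ⟨rfl, -⟩ := List.append_inj' h' rfl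
    simp at ha

end OrderedPartitions

section LinearOrder

variable {A : Type*} [LinearOrder A]

/-- The ordered partition of `S` into singletons, in increasing order. -/
def sortedSingletons (S : Finset A) : List (Finset A) :=
  (S.sort (· ≤ ·)).map fun a => ({a} : Finset A)

theorem isOPart_sortedSingletons (S : Finset A) : IsOPart S (sortedSingletons S) := by
  refine ⟨by simp [sortedSingletons], ?_, ?_⟩
  · simpa [sortedSingletons, List.pairwise_map, List.Nodup] using S.sort_nodup (· ≤ ·)
  · ext a
    simp [sortedSingletons, mem_blocksUnion]

theorem sortedSingletons_insert {s : Finset A} {a : A} (h : ∀ x ∈ s, x < a) :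
    sortedSingletons (insert a s) = sortedSingletons s ++ [{a}] := by
  have key : (insert a s).sort (· ≤ ·) = s.sort (· ≤ ·) ++ [a] := by
    have ha : a ∉ s := fun ha => (h a ha).false
    refine List.Perm.eq_of_pairwise (le := (· ≤ ·)) (fun _ _ _ _ => le_antisymm)
      (Finset.pairwise_sort _ _) ?_ ?_
    · rw [List.pairwise_append]
      refine ⟨Finset.pairwise_sort _ _, by simp, ?_⟩
      simpa using fun x hx => (h x hx).le
    · rw [List.perm_ext_iff_of_nodup (Finset.sort_nodup _ _)]
      · simp [or_comm]
      · rw [List.nodup_append]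
        simp [Finset.sort_nodup]
        grind
  simp [sortedSingletons, key]

theorem pdim_sortedSingletons (S : Finset A) : pdim (sortedSingletons S) = 0 := by
  simp [pdim, sortedSingletons, Function.comp_def]

/-- The pairs of the field on `insert a s` which merge the block `{a}` with its successor. -/
def MergeMax (s : Finset A) (a : A) (x y : List (Finset A)) : Prop :=
  ∃ (C B D : Finset A) (π ρ : List (Finset A)), B.Nonempty ∧ Disjoint C B ∧ Disjoint C D ∧
    Disjoint B D ∧ C ∪ B ∪ D = s ∧ IsOPart C π ∧ IsOPart D ρ ∧
    x = π ++ [{a}] ++ [B] ++ ρ ∧ y = π ++ [insert a B] ++ ρ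

theorem memV_iff {S : Finset A} {x y : List (Finset A)} :
    memV S x y ↔ ∃ hS : S.Nonempty,
      (∃ x' y', memV (S.erase (S.max' hS)) x' y' ∧ x = x' ++ [{S.max' hS}] ∧
        y = y' ++ [{S.max' hS}]) ∨ MergeMax (S.erase (S.max' hS)) (S.max' hS) x y := by
  constructor
  · rintro (⟨_, hS, x, y, h⟩ | ⟨_, hS, C, B, D, π, ρ, h₁, h₂, h₃, h₄, h₅, h₆, h₇⟩)
    · exact ⟨hS, .inl ⟨x, y, h, rfl, rfl⟩⟩
    · exact ⟨hS, .inr ⟨C, B, D, π, ρ, h₁, h₂, h₃, h₄, h₅, h₆, h₇, rfl, rfl⟩⟩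
  · rintro ⟨hS, ⟨x, y, h, rfl, rfl⟩ | ⟨C, B, D, π, ρ, h₁, h₂, h₃, h₄, h₅, h₆, h₇, rfl, rfl⟩⟩
    · exact .mstep S hS x y h
    · exact .rstep S hS C B D π ρ h₁ h₂ h₃ h₄ h₅ h₆ h₇

theorem memV_insert {s : Finset A} {a : A} (h : ∀ x ∈ s, x < a) {x y : List (Finset A)} :
    memV (insert a s) x y ↔
      (∃ x' y', memV s x' y' ∧ x = x' ++ [{a}] ∧ y = y' ++ [{a}]) ∨ MergeMax s a x y := by
  have hmax : ∀ hS : (insert a s).Nonempty, (insert a s).max' hS = a := fun hS =>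
    le_antisymm (Finset.max'_le _ _ _ (by simpa using fun x hx => (h x hx).le))
      (Finset.le_max' _ _ (by simp))
  have herase : (insert a s).erase a = s :=
    Finset.erase_insert fun ha => (h a ha).false
  rw [memV_iff]
  simp [hmax, herase]

theorem memV_ne_sortedSingletons {S : Finset A} {x y : List (Finset A)} (h : memV S x y) :
    x ≠ sortedSingletons S ∧ y ≠ sortedSingletons S := by
  induction S using Finset.induction_on_max generalizing x y with
  | empty => exact absurd (memV_iff.1 h).1 (by simp)
  | insert a s hlt ih =>
    have ha : a ∉ s := fun ha => (hlt a ha).false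
    rw [sortedSingletons_insert hlt]
    rcases (memV_insert hlt).1 h with ⟨x, y, hxy, rfl, rfl⟩ |
      ⟨C, B, D, π, ρ, hB, -, -, -, hU, -, -, rfl, rfl⟩
    · simpa using ih hxy
    · have hmem : ∀ E : Finset A, a ∈ E → E ∉ sortedSingletons s := by
        rintro E haE hE
        apply ha
        rw [← (isOPart_sortedSingletons s).2.2, mem_blocksUnion]
        exact ⟨E, hE, haE⟩
      constructor
      · intro he
        have := append_cons_eq_append_singleton (l₁ := π) (l₂ := B :: ρ) (by simpa using he)
          (hmem {a} (by simp))
        simp at this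
      · intro he
        have := append_cons_eq_append_singleton (l₁ := π) (l₂ := ρ) (by simpa using he)
          (hmem (insert a B) (by simp))
        obtain ⟨b, hb⟩ := hB
        have hba : b = a := by
          rw [← Finset.mem_singleton, ← this.2.2]
          exact Finset.mem_insert_of_mem hb
        subst hba
        exact ha (by simp [← hU, hb])

theorem exists_memV_of_ne_sortedSingletons {S : Finset A} {x : List (Finset A)}
    (hx : IsOPart S x) (hne : x ≠ sortedSingletons S) : ∃ y, memV S x y ∨ memV S y x := by
  induction S using Finset.induction_on_max generalizing x with
  | empty => exact absurd (isOPart_empty hx) (by simpa [sortedSingletons] using hne)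
  | insert a s hlt ih =>
    have ha : a ∉ s := fun ha => (hlt a ha).false
    have hax : a ∈ blocksUnion x := by simp [hx.2.2]
    obtain ⟨E, hE, haE⟩ := mem_blocksUnion.1 hax
    obtain ⟨π, σ, rfl⟩ := List.append_of_mem hE
    simp only [memV_insert hlt]
    rw [sortedSingletons_insert hlt] at hne
    obtain ⟨hπ, hEσ, hd, hU⟩ := isOPart_append.1 hx
    obtain ⟨-, hσ, hd', -⟩ := isOPart_cons.1 hEσ
    rw [blocksUnion_cons] at hd hU
    simp only [Finset.disjoint_left, Finset.mem_union] at hd hd'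
    simp only [Finset.ext_iff, Finset.mem_union, Finset.mem_insert] at hU
    by_cases hEa : E = {a}
    · subst hEa
      simp only [Finset.mem_singleton] at hd hd' hU
      cases σ with
      | nil =>
        have hs : blocksUnion π = s := by
          have h0 : ∀ b, b ∉ blocksUnion ([] : List (Finset A)) := by simp [mem_blocksUnion]
          ext b
          grind
        obtain ⟨y, hy⟩ := ih (hs ▸ hπ) (by simpa using hne)
        exact ⟨y ++ [{a}], hy.imp (fun h => .inl ⟨π, y, h, rfl, rfl⟩)
          (fun h => .inl ⟨y, π, h, rfl, rfl⟩)⟩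
      | cons B ρ =>
        obtain ⟨hB, hρ, hBρ, -⟩ := isOPart_cons.1 hσ
        simp only [blocksUnion_cons, Finset.mem_union] at hd hd' hU
        refine ⟨_, .inl (.inr ⟨blocksUnion π, B, blocksUnion ρ, π, ρ, hB, ?_, ?_, hBρ, ?_, hπ, hρ,
          by simp, rfl⟩)⟩
        · rw [Finset.disjoint_left]; grind
        · rw [Finset.disjoint_left]; grind
        · ext b; grind
    · refine ⟨_, .inr (.inr ⟨blocksUnion π, E.erase a, blocksUnion σ, π, σ, ?_, ?_, ?_, ?_, ?_, hπ,
        hσ, rfl, by simp [Finset.insert_erase haE]⟩)⟩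
      · rw [Finset.nonempty_iff_ne_empty, Ne, Finset.erase_eq_empty_iff]
        rintro (rfl | h)
        · simp at haE
        · exact hEa h
      · rw [Finset.disjoint_left]; grind
      · rw [Finset.disjoint_left]; grind
      · rw [Finset.disjoint_left]; grind
      · ext b; grind

end LinearOrder

/-- The discrete vector field `V_A` on the poset `P_A` of ordered
partitions of a finite nonempty linearly ordered set `A = {a₁ < … < a_n}` has exactly
one critical cell, namely the `0`-dimensional cell `u_A = a₁|a₂|…|a_n`. -/
theorem stmt_6 {A : Type*} [LinearOrder A] [Fintype A] [Nonempty A] :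
    CritOn {L | IsOPart Finset.univ L}
        {p : List (Finset A) × List (Finset A) | memV Finset.univ p.1 p.2} =
      {(Finset.univ.sort (· ≤ ·)).map fun a => ({a} : Finset A)} ∧
    pdim ((Finset.univ.sort (· ≤ ·)).map fun a => ({a} : Finset A)) = 0 := by
  refine ⟨Set.eq_singleton_iff_unique_mem.2 ⟨⟨isOPart_sortedSingletons _, fun p hp =>
    memV_ne_sortedSingletons hp⟩, ?_⟩, pdim_sortedSingletons _⟩
  rintro x ⟨hx, hcrit⟩
  by_contra hne
  obtain ⟨y, h | h⟩ := exists_memV_of_ne_sortedSingletons hx hne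
  · exact (hcrit (x, y) h).1 rfl
  · exact (hcrit (y, x) h).2 rfl
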